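/- Fix n ∈ ℕ, n ≥ 1. Let x_1 = −1 and x_2,…,x_{n+1} be pairwise distinct points of (−1,1), with weights w_1,…,w_{n+1} ∈ ℝ such that Σ_{i=1}^{n+1} w_i p(x_i) = ∫_{−1}^{1} p(x)dx for every polynomial p of degree at most 2n, and let y_1,…,y_n be pairwise distinct points of (−1,1) and y_{n+1} = 1, with weights v_1,…,v_{n+1} ∈ ℝ such that Σ_{i=1}^{n+1} v_i p(y_i) = ∫_{−1}^{1} p(x)dx for every polynomial p of degree at most 2n. Then for every 2n-convex function f : [−1,1] → ℝ one has the Hadamard-type inequality Σ_{i=1}^{n+1} w_i f(x_i) ≤ ∫_{−1}^{1} f(x)dx ≤ Σ_{i=1}^{n+1} v_i f(y_i). -/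

import Mathlib

/-- `f` is `n`-convex on `s ⊆ ℝ`: every divided difference
`[x₁,…,x_{n+2}; f] = ∑ i, f(xᵢ)/∏_{j≠i}(xᵢ-xⱼ)` of `f` at `n+2` pairwise
distinct points of `s` is nonnegative. -/
def NConvexOn (n : ℕ) (s : Set ℝ) (f : ℝ → ℝ) : Prop :=
  ∀ x : Fin (n + 2) → ℝ, Function.Injective x → (∀ i, x i ∈ s) →
    0 ≤ ∑ i, f (x i) / ∏ j ∈ Finset.univ.erase i, (x i - x j)

theorem Option.elim_injective {α β : Type*} {c : β} {u : α → β} (hu : Function.Injective u)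
    (hc : ∀ i, u i ≠ c) : Function.Injective (fun o : Option α => o.elim c u) := by
  rintro (_ | i) (_ | j) h
  · rfl
  · exact absurd h.symm (hc j)
  · exact absurd h (hc i)
  · exact congrArg some (hu h)

theorem NConvexOn.sum_div_prod_nonneg {ι : Type*} [Fintype ι] [DecidableEq ι] {m : ℕ} {s : Set ℝ}
    {f : ℝ → ℝ} (hf : NConvexOn m s f) (hι : Fintype.card ι = m + 2) {v : ι → ℝ}
    (hv : Function.Injective v) (hvs : ∀ i, v i ∈ s) :
    0 ≤ ∑ i, f (v i) / ∏ j ∈ Finset.univ.erase i, (v i - v j) := by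
  let e : Fin (m + 2) ≃ ι := (Fintype.equivFinOfCardEq hι).symm
  have h := hf (v ∘ e) (hv.comp e.injective) fun i => hvs _
  rw [← Equiv.sum_comp e]
  refine h.trans_eq (Finset.sum_congr rfl fun i _ => congrArg (f (v (e i)) / ·) ?_)
  exact Finset.prod_equiv e (by simp) fun _ _ => rfl

/-- The error of Lagrange interpolation of an `m`-convex function at `m + 1` nodes has the sign of
the nodal polynomial. -/
theorem NConvexOn.sub_interpolate_mul_prod_nonneg {ι : Type*} [Fintype ι] [DecidableEq ι] {m : ℕ}
    {s : Set ℝ} {f : ℝ → ℝ} (hf : NConvexOn m s f) (hι : Fintype.card ι = m + 1) {v : ι → ℝ}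
    (hv : Function.Injective v) (hvs : ∀ i, v i ∈ s) {t : ℝ} (ht : t ∈ s) :
    0 ≤ (f t - (Lagrange.interpolate Finset.univ v (f ∘ v)).eval t) * ∏ i, (t - v i) := by
  by_cases htv : ∃ i, t = v i
  · obtain ⟨i, rfl⟩ := htv
    rw [Finset.prod_eq_zero (Finset.mem_univ i) (sub_self _), mul_zero]
  push Not at htv
  have hinj := Option.elim_injective hv fun i => (htv i).symm
  have h := hf.sum_div_prod_nonneg (ι := Option ι) (by simp [hι]) hinj (by
    rintro (_ | i)
    · exact ht
    · exact hvs i)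
  have hne : ∏ i, (t - v i) ≠ 0 := Finset.prod_ne_zero_iff.2 fun i _ => sub_ne_zero.2 (htv i)
  have hpos : 0 < (∏ i, (t - v i)) ^ 2 := by positivity
  refine le_of_le_of_eq (mul_nonneg hpos.le h) ?_
  have hnone : (Finset.univ.erase (none : Option ι)) = Finset.univ.map Function.Embedding.some := by
    ext (_ | i) <;> simp
  have hsome (i : ι) : (Finset.univ.erase (some i)) = Finset.insertNone (Finset.univ.erase i) := by
    ext (_ | j) <;> simp
  rw [Fintype.sum_option, hnone, Lagrange.eval_interpolate_not_at_node _ (fun i _ => htv i),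
    Lagrange.eval_nodal]
  simp only [hsome, Finset.prod_insertNone, Finset.prod_map, Option.elim,
    Function.Embedding.some_apply]
  have hsum : ∑ i, f (v i) / ((v i - t) * ∏ j ∈ Finset.univ.erase i, (v i - v j)) =
      - ∑ i, Lagrange.nodalWeight Finset.univ v i * (t - v i)⁻¹ * (f ∘ v) i := by
    rw [← Finset.sum_neg_distrib]
    refine Finset.sum_congr rfl fun i _ => ?_
    rw [Lagrange.nodalWeight, Finset.prod_inv_distrib, div_eq_mul_inv, mul_inv,
      ← neg_sub t (v i), inv_neg, Function.comp_apply]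
    ring
  rw [hsum]
  field_simp
  ring

/-- Between two points `a ≤ b` an `m`-convex function lies between its interpolants at the nodes
`a, u` and `b, u`. -/
theorem NConvexOn.abs_sub_interpolate_le {ι : Type*} [Fintype ι] [DecidableEq ι] {m : ℕ}
    {a b : ℝ} {f : ℝ → ℝ} (hf : NConvexOn m (Set.Icc a b) f)
    (hι : Fintype.card ι = m) {u : ι → ℝ} (hu : Function.Injective u)
    (hus : ∀ i, u i ∈ Set.Ioo a b) {t : ℝ} (ht : t ∈ Set.Ioo a b) :
    let P (c : ℝ) := Lagrange.interpolate Finset.univ (fun o : Option ι => o.elim c u)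
      (f ∘ fun o : Option ι => o.elim c u)
    |f t - (P a).eval t| ≤ |(P b).eval t - (P a).eval t| := by
  intro P
  have hab : a < b := ht.1.trans ht.2
  have hinj (c : ℝ) (hc : c ∉ Set.Ioo a b) :
      Function.Injective (fun o : Option ι => o.elim c u) :=
    Option.elim_injective hu fun i h => hc (h ▸ hus i)
  have hsign (c : ℝ) (hc : c ∉ Set.Ioo a b) (hc' : c ∈ Set.Icc a b) :
      0 ≤ (f t - (P c).eval t) * ((t - c) * ∏ i, (t - u i)) := by
    have := hf.sub_interpolate_mul_prod_nonneg (ι := Option ι) (by simp [hι]) (hinj c hc) (by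
      rintro (_ | i)
      · exact hc'
      · exact Set.Ioo_subset_Icc_self (hus i)) (Set.Ioo_subset_Icc_self ht)
    rwa [Fintype.prod_option] at this
  by_cases htu : ∃ i, t = u i
  · obtain ⟨i, rfl⟩ := htu
    have : (P a).eval (u i) = f (u i) :=
      Lagrange.eval_interpolate_at_node (s := Finset.univ) (i := some i) _
        (hinj a (by simp)).injOn (Finset.mem_univ _)
    simp [this]
  push Not at htu
  have hne : ∏ i, (t - u i) ≠ 0 := Finset.prod_ne_zero_iff.2 fun i _ => sub_ne_zero.2 (htu i)
  have ha := hsign a (by simp) (by simp [hab.le])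
  have hb := hsign b (by simp) (by simp [hab.le])
  set A := (P a).eval t
  set B := (P b).eval t
  set q := ∏ i, (t - u i)
  have h1 : 0 < t - a := sub_pos.2 ht.1
  have h2 : 0 < b - t := sub_pos.2 ht.2
  have ha' : 0 ≤ (f t - A) * q := by
    refine nonneg_of_mul_nonneg_left (b := t - a) ?_ h1
    linarith
  have hb' : 0 ≤ (B - f t) * q := by
    refine nonneg_of_mul_nonneg_left (b := b - t) ?_ h2
    linarith
  rcases lt_or_gt_of_ne hne with hq | hq
  · have := nonpos_of_mul_nonneg_left ha' hq
    have := nonpos_of_mul_nonneg_left hb' hq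
    rw [abs_of_nonpos, abs_of_nonpos] <;> linarith
  · have := nonneg_of_mul_nonneg_left ha' hq
    have := nonneg_of_mul_nonneg_left hb' hq
    rw [abs_of_nonneg, abs_of_nonneg] <;> linarith

theorem exists_injective_option_mem_Ioo (k : ℕ) {a b t : ℝ} (ht : t ∈ Set.Ioo a b) :
    ∃ u : Option (Fin k) → ℝ, Function.Injective u ∧ (∀ i, u i ∈ Set.Ioo a b) ∧ u none = t := by
  have hinf : (Set.Ioo a b \ {t}).Infinite :=
    (Set.Ioo_infinite (ht.1.trans ht.2)).sdiff (Set.finite_singleton t)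
  let g := hinf.natEmbedding
  refine ⟨fun o => o.elim t fun i => g i, ?_, ?_, rfl⟩
  · rintro (_ | i) (_ | j) h
    · rfl
    · exact absurd h.symm (g j).2.2
    · exact absurd h (g i).2.2
    · simpa [Subtype.val_inj, Fin.val_inj] using h
  · rintro (_ | i)
    · exact ht
    · exact (g i).2.1

theorem NConvexOn.continuousOn_Ioo {m : ℕ} (hm : 1 ≤ m) {a b : ℝ} {f : ℝ → ℝ}
    (hf : NConvexOn m (Set.Icc a b) f) : ContinuousOn f (Set.Ioo a b) := by
  intro t ht
  refine ContinuousAt.continuousWithinAt ?_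
  obtain ⟨u, hu, hus, hut⟩ := exists_injective_option_mem_Ioo (m - 1) ht
  have hle := fun s (hs : s ∈ Set.Ioo a b) =>
    hf.abs_sub_interpolate_le (by simp; omega) hu hus hs
  set P := fun (c : ℝ) => Lagrange.interpolate Finset.univ (fun o => Option.elim o c u)
      (f ∘ fun o => Option.elim o c u)
  have hP (c : ℝ) (hc : c ∉ Set.Ioo a b) : (P c).eval t = f t := by
    have hinj := Option.elim_injective hu fun i (h : u i = c) => hc (h ▸ hus i)
    have := Lagrange.eval_interpolate_at_node (s := Finset.univ) (i := some none)
      (f ∘ fun o => Option.elim o c u) hinj.injOn (Finset.mem_univ _)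
    rw [← hut]
    exact this
  have h0 : Filter.Tendsto (fun s => f s - (P a).eval s) (nhds t) (nhds 0) := by
    refine squeeze_zero_norm' (a := fun s => |(P b).eval s - (P a).eval s|) ?_ ?_
    · filter_upwards [Ioo_mem_nhds ht.1 ht.2] with s hs using hle s hs
    · have : Continuous fun s => |(P b).eval s - (P a).eval s| := by fun_prop
      simpa [hP a (by simp), hP b (by simp)] using this.tendsto t
  have h1 := h0.add ((P a).continuous.tendsto t)
  simpa [ContinuousAt, hP a (by simp)] using h1

theorem NConvexOn.exists_abs_le {m : ℕ} (hm : 1 ≤ m) {a b : ℝ} {f : ℝ → ℝ}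
    (hf : NConvexOn m (Set.Icc a b) f) : ∃ M, ∀ t ∈ Set.Icc a b, |f t| ≤ M := by
  by_cases hab : a < b
  swap
  · refine ⟨|f a|, fun t ht => ?_⟩
    rw [show t = a by linarith [ht.1, ht.2]]
  obtain ⟨u, hu, hus, -⟩ :=
    exists_injective_option_mem_Ioo (m - 1) (a := a) (b := b)
      (t := (a + b) / 2) ⟨by linarith, by linarith⟩
  have hle := fun s (hs : s ∈ Set.Ioo a b) =>
    hf.abs_sub_interpolate_le (by simp; omega) hu hus hs
  set P := fun (c : ℝ) => Lagrange.interpolate Finset.univ (fun o => Option.elim o c u)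
      (f ∘ fun o => Option.elim o c u)
  obtain ⟨M, hM⟩ := (isCompact_Icc (a := a) (b := b)).exists_bound_of_continuousOn
    (f := fun s => |(P b).eval s - (P a).eval s| + |(P a).eval s|)
    (Continuous.continuousOn (by fun_prop))
  refine ⟨max M (max |f a| |f b|), fun t ht => ?_⟩
  rcases eq_or_lt_of_le ht.1 with rfl | h1
  · simp
  rcases eq_or_lt_of_le ht.2 with rfl | h2
  · simp
  refine le_max_of_le_left ?_
  have h3 := hle t ⟨h1, h2⟩
  have h4 := hM t ht
  rw [Real.norm_of_nonneg (by positivity)] at h4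
  have h5 := abs_add_le (f t - (P a).eval t) ((P a).eval t)
  rw [sub_add_cancel] at h5
  exact h5.trans ((add_le_add_left h3 _).trans h4)

theorem NConvexOn.intervalIntegrable {m : ℕ} (hm : 1 ≤ m) {a b : ℝ} (hab : a ≤ b) {f : ℝ → ℝ}
    (hf : NConvexOn m (Set.Icc a b) f) : IntervalIntegrable f MeasureTheory.volume a b := by
  obtain ⟨M, hM⟩ := hf.exists_abs_le hm
  rw [intervalIntegrable_iff_integrableOn_Ioo_of_le hab]
  refine MeasureTheory.Integrable.of_bound
    ((hf.continuousOn_Ioo hm).aestronglyMeasurable measurableSet_Ioo) M ?_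
  filter_upwards [MeasureTheory.ae_restrict_mem measurableSet_Ioo] with t ht
  exact hM t (Set.Ioo_subset_Icc_self ht)

theorem Lagrange.abs_eval_interpolate_le {ι : Type*} [Fintype ι] [DecidableEq ι] {v r : ι → ℝ}
    {t M C : ℝ} (hr : ∀ i, |r i| ≤ M) (hC : ∀ i, ∏ j ∈ Finset.univ.erase i, |t - v j| ≤
      C * ∏ j ∈ Finset.univ.erase i, |v i - v j|) (hv : Function.Injective v) :
    |(Lagrange.interpolate Finset.univ v r).eval t| ≤ Fintype.card ι * (M * C) := by
  rw [Lagrange.interpolate_apply, Polynomial.eval_finsetSum]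
  refine (Finset.abs_sum_le_sum_abs _ _).trans ?_
  rw [← nsmul_eq_mul]
  refine Finset.sum_le_card_nsmul _ _ _ fun i _ => ?_
  rw [Polynomial.eval_mul, Polynomial.eval_C, abs_mul]
  refine mul_le_mul (hr i) ?_ (abs_nonneg _) ((abs_nonneg _).trans (hr i))
  have hpos : 0 < ∏ j ∈ Finset.univ.erase i, |v i - v j| :=
    Finset.prod_pos fun j hj => abs_pos.2 (sub_ne_zero.2 (hv.ne (Finset.ne_of_mem_erase hj).symm))
  rw [Lagrange.basis, Polynomial.eval_prod, Finset.abs_prod]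
  refine le_of_eq_of_le ?_ ((div_le_iff₀ hpos).2 (hC i))
  rw [← Finset.prod_div_distrib]
  refine Finset.prod_congr rfl fun j _ => ?_
  simp [Lagrange.basisDivisor, abs_mul, abs_inv, div_eq_inv_mul]

theorem Finset.prod_le_mul_pow_card {ι : Type*} {s : Finset ι} {g : ι → ℝ} {ε B : ℝ} (hε : 0 ≤ ε)
    (hB : 1 ≤ B) (hg : ∀ i ∈ s, 0 ≤ g i) (hgB : ∀ i ∈ s, g i ≤ B) {i₀ : ι} (hi₀ : i₀ ∈ s)
    (h : g i₀ ≤ ε) : ∏ i ∈ s, g i ≤ ε * B ^ s.card := by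
  classical
  rw [← Finset.mul_prod_erase s g hi₀]
  have h1 : ∏ i ∈ s.erase i₀, g i ≤ B ^ (s.erase i₀).card :=
    (Finset.prod_le_prod (fun i hi => hg i (Finset.mem_of_mem_erase hi))
      fun i hi => hgB i (Finset.mem_of_mem_erase hi)).trans_eq (Finset.prod_const B)
  have h2 : B ^ (s.erase i₀).card ≤ B ^ s.card :=
    pow_le_pow_right₀ hB (Finset.card_le_card (Finset.erase_subset _ _))
  exact mul_le_mul h (h1.trans h2)
    (Finset.prod_nonneg fun i hi => hg i (Finset.mem_of_mem_erase hi)) hε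

theorem Finset.mul_pow_card_le_prod {ι : Type*} {s : Finset ι} {g : ι → ℝ} {ε δ : ℝ} (hε : 0 ≤ ε)
    (hε1 : ε ≤ 1) (hδ : 0 ≤ δ) (hδ1 : δ ≤ 1) {i₀ : ι} (h : ε ≤ g i₀)
    (hg : ∀ i ∈ s, i ≠ i₀ → δ ≤ g i) : ε * δ ^ s.card ≤ ∏ i ∈ s, g i := by
  classical
  have key : δ ^ s.card ≤ ∏ i ∈ s.erase i₀, g i :=
    calc δ ^ s.card ≤ δ ^ (s.erase i₀).card :=
          pow_le_pow_of_le_one hδ hδ1 (Finset.card_le_card (Finset.erase_subset _ _))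
      _ = ∏ _i ∈ s.erase i₀, δ := (Finset.prod_const δ).symm
      _ ≤ _ := Finset.prod_le_prod (fun _ _ => hδ) fun i hi =>
          hg i (Finset.mem_of_mem_erase hi) (Finset.ne_of_mem_erase hi)
  have hδs : 0 ≤ δ ^ s.card := by positivity
  by_cases hi : i₀ ∈ s
  · rw [← Finset.mul_prod_erase s g hi]
    exact mul_le_mul h key hδs (hε.trans h)
  · rw [Finset.erase_eq_of_notMem hi] at key
    exact (mul_le_of_le_one_left hδs hε1).trans key

theorem exists_pos_forall_two_mul_le_abs_sub {κ : Type*} [Finite κ] {x : κ → ℝ}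
    (hx : Function.Injective x) {e b : ℝ} (hxe : ∀ i, x i ≠ e) (hxb : ∀ i, x i < b) :
    ∃ δ : ℝ, 0 < δ ∧ δ ≤ 1 ∧ (∀ i, 2 * δ ≤ |x i - e|) ∧
      (∀ i j, i ≠ j → 2 * δ ≤ |x i - x j|) ∧ ∀ i, x i + δ ≤ b := by
  have key (c : ℝ) (hc : 0 < c) : ∀ᶠ δ in nhdsWithin (0 : ℝ) (Set.Ioi 0), 2 * δ ≤ c := by
    filter_upwards [Ioo_mem_nhdsGT (half_pos hc)] with δ hδ
    linarith [hδ.2]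
  have h1 : ∀ᶠ δ in nhdsWithin (0 : ℝ) (Set.Ioi 0), ∀ i, 2 * δ ≤ |x i - e| :=
    Filter.eventually_all.2 fun i => key _ (abs_pos.2 (sub_ne_zero.2 (hxe i)))
  have h2 : ∀ᶠ δ in nhdsWithin (0 : ℝ) (Set.Ioi 0), ∀ i j, i ≠ j → 2 * δ ≤ |x i - x j| := by
    refine Filter.eventually_all.2 fun i => Filter.eventually_all.2 fun j => ?_
    by_cases hij : i = j
    · simp [hij]
    · filter_upwards [key _ (abs_pos.2 (sub_ne_zero.2 (hx.ne hij)))] with δ hδ _ using hδ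
  have h3 : ∀ᶠ δ in nhdsWithin (0 : ℝ) (Set.Ioi 0), ∀ i, 2 * δ ≤ b - x i :=
    Filter.eventually_all.2 fun i => key _ (sub_pos.2 (hxb i))
  obtain ⟨δ, h1, h2, h3, h4, h5⟩ := (h1.and (h2.and (h3.and
    ((key 1 one_pos).and self_mem_nhdsWithin)))).exists
  have h5 : 0 < δ := h5
  exact ⟨δ, h5, by linarith, h1, h2, fun i => by linarith [h3 i]⟩

/-- The node `e` together with the nodes `x i` and `x i + ε`. -/
def doubledNodes {κ : Type*} (e : ℝ) (x : κ → ℝ) (ε : ℝ) (o : Option (κ × Bool)) : ℝ :=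
  o.elim e fun p => x p.1 + if p.2 then ε else 0

section doubledNodes

variable {κ : Type*} {e : ℝ} {x : κ → ℝ} {ε δ : ℝ}

theorem le_abs_doubledNodes_sub (hε : 0 < ε) (hεδ : ε ≤ δ) (hδe : ∀ i, 2 * δ ≤ |x i - e|)
    (hδx : ∀ i j, i ≠ j → 2 * δ ≤ |x i - x j|) {o o' : Option (κ × Bool)} (hne : o ≠ o')
    (hp : ∀ i b, o = some (i, b) → o' ≠ some (i, !b)) :
    δ ≤ |doubledNodes e x ε o - doubledNodes e x ε o'| := by
  have tri (c d : ℝ) (hc : 2 * δ ≤ |c|) (hd : |d| ≤ ε) : δ ≤ |c + d| := by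
    have := abs_sub_abs_le_abs_sub c (-d)
    rw [abs_neg, sub_neg_eq_add] at this
    linarith
  have hb (b : Bool) : |if b then ε else 0| ≤ ε := by cases b <;> simp [abs_of_pos hε, hε.le]
  rcases o with _ | ⟨i, b⟩ <;> rcases o' with _ | ⟨j, c⟩
  · exact absurd rfl hne
  · simp only [doubledNodes, Option.elim]
    rw [abs_sub_comm, add_sub_right_comm]
    exact tri _ _ (hδe j) (hb c)
  · simp only [doubledNodes, Option.elim]
    rw [add_sub_right_comm]
    exact tri _ _ (hδe i) (hb b)
  · have hij : i ≠ j := by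
      rintro rfl
      have h := hp i b rfl
      cases b <;> cases c <;> simp_all
    simp only [doubledNodes, Option.elim]
    rw [add_sub_add_comm]
    refine tri _ _ (hδx i j hij) ?_
    cases b <;> cases c <;> simp [abs_of_pos hε, hε.le]

theorem abs_doubledNodes_sub_not (hε : 0 < ε) (i : κ) (b : Bool) :
    |doubledNodes e x ε (some (i, b)) - doubledNodes e x ε (some (i, !b))| = ε := by
  cases b <;> simp [doubledNodes, abs_of_pos hε]

theorem doubledNodes_injective (hε : 0 < ε) (hεδ : ε ≤ δ) (hδe : ∀ i, 2 * δ ≤ |x i - e|)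
    (hδx : ∀ i j, i ≠ j → 2 * δ ≤ |x i - x j|) : Function.Injective (doubledNodes e x ε) := by
  intro o o' h
  by_contra hne
  have h0 := sub_eq_zero.2 h
  by_cases hp : ∀ i b, o = some (i, b) → o' ≠ some (i, !b)
  · have := le_abs_doubledNodes_sub hε hεδ hδe hδx hne hp
    rw [h0, abs_zero] at this
    linarith
  · push Not at hp
    obtain ⟨i, b, rfl, rfl⟩ := hp
    have := abs_doubledNodes_sub_not (e := e) (x := x) hε i b
    rw [h0, abs_zero] at this
    linarith

variable [Fintype κ] [DecidableEq κ]

theorem mul_pow_le_prod_abs_doubledNodes_sub (hε : 0 < ε) (hεδ : ε ≤ δ) (hδ1 : δ ≤ 1)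
    (hδe : ∀ i, 2 * δ ≤ |x i - e|) (hδx : ∀ i j, i ≠ j → 2 * δ ≤ |x i - x j|)
    (o : Option (κ × Bool)) :
    ε * δ ^ (Finset.univ.erase o).card ≤
      ∏ o' ∈ Finset.univ.erase o, |doubledNodes e x ε o - doubledNodes e x ε o'| := by
  have hδ : 0 < δ := hε.trans_le hεδ
  rcases o with _ | ⟨i, b⟩
  · have h : δ ^ (Finset.univ.erase (none : Option (κ × Bool))).card ≤
        ∏ o' ∈ Finset.univ.erase none, |doubledNodes e x ε none - doubledNodes e x ε o'| := by
      rw [← Finset.prod_const]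
      refine Finset.prod_le_prod (fun _ _ => hδ.le) fun o' ho' => ?_
      exact le_abs_doubledNodes_sub hε hεδ hδe hδx (Finset.ne_of_mem_erase ho').symm (by simp)
    exact (mul_le_of_le_one_left (by positivity) (hεδ.trans hδ1)).trans h
  · refine Finset.mul_pow_card_le_prod (i₀ := some (i, !b)) hε.le (hεδ.trans hδ1) hδ.le hδ1
      (abs_doubledNodes_sub_not hε i b).ge fun o' ho' hne => ?_
    refine le_abs_doubledNodes_sub hε hεδ hδe hδx (Finset.ne_of_mem_erase ho').symm ?_
    intro j c h
    obtain ⟨rfl, rfl⟩ : i = j ∧ b = c := by simpa using h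
    exact hne

theorem prod_abs_sub_doubledNodes_le (hε : 0 < ε)
    (hmem : ∀ o, doubledNodes e x ε o ∈ Set.Icc (-1 : ℝ) 1) {t : ℝ} (ht : t ∈ Set.Icc (-1 : ℝ) 1)
    {i : κ} (hti : t ∈ Set.Icc (x i) (x i + ε)) (o : Option (κ × Bool)) :
    ∏ o' ∈ Finset.univ.erase o, |t - doubledNodes e x ε o'| ≤
      ε * 2 ^ (Finset.univ.erase o).card := by
  obtain ⟨b, hb⟩ : ∃ b, some (i, b) ≠ o := by
    by_contra! h
    have := (h true).trans (h false).symm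
    simp at this
  refine Finset.prod_le_mul_pow_card (i₀ := some (i, b)) hε.le one_le_two
    (fun _ _ => abs_nonneg _) (fun o' _ => ?_) (Finset.mem_erase.2 ⟨hb, Finset.mem_univ _⟩) ?_
  · rw [abs_le]
    constructor <;> linarith [(hmem o').1, (hmem o').2, ht.1, ht.2]
  · simp only [doubledNodes, Option.elim]
    rw [abs_le]
    cases b <;> simp <;> constructor <;> linarith [hti.1, hti.2]

end doubledNodes

/-- One-sided bound for a quadrature rule with a fixed node `e` outside the open interval: the sign
`σ` is `1` for `e = -1` and `-1` for `e = 1`. -/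
theorem NConvexOn.quadrature_le {κ : Type*} [Fintype κ] {f : ℝ → ℝ}
    (hf : NConvexOn (2 * Fintype.card κ) (Set.Icc (-1 : ℝ) 1) f) (hκ : 1 ≤ Fintype.card κ)
    {e σ : ℝ} (he : e ∈ Set.Icc (-1 : ℝ) 1) (hσ : |σ| = 1)
    (hσe : ∀ t ∈ Set.Icc (-1 : ℝ) 1, 0 ≤ σ * (t - e)) {x : κ → ℝ} (hx : Function.Injective x)
    (hxe : ∀ i, x i ≠ e) (hxI : ∀ i, x i ∈ Set.Ioo (-1 : ℝ) 1) {w₀ : ℝ} {w : κ → ℝ}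
    (hrule : ∀ p : Polynomial ℝ, p.natDegree ≤ 2 * Fintype.card κ →
      w₀ * p.eval e + ∑ i, w i * p.eval (x i) = ∫ t in (-1 : ℝ)..1, p.eval t) :
    σ * (w₀ * f e + ∑ i, w i * f (x i)) ≤ σ * ∫ t in (-1 : ℝ)..1, f t := by
  classical
  obtain ⟨M, hM⟩ := hf.exists_abs_le (by omega)
  have hfint := hf.intervalIntegrable (by omega) (by norm_num)
  obtain ⟨δ, hδ, hδ1, hδe, hδx, hδb⟩ :=
    exists_pos_forall_two_mul_le_abs_sub hx hxe fun i => (hxI i).2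
  set N := Fintype.card (Option (κ × Bool)) with hN
  have hN' : N = 2 * Fintype.card κ + 1 := by simp [hN, mul_comm]
  set C := (2 / δ) ^ (2 * Fintype.card κ)
  have hM0 : 0 ≤ M := (abs_nonneg _).trans (hM e he)
  set K := M + N * (M * C)
  have hK : 0 ≤ K := by positivity
  have key (ε : ℝ) (hε : 0 < ε) (hεδ : ε ≤ δ) :
      σ * (w₀ * f e + ∑ i, w i * f (x i)) - K * Fintype.card κ * ε ≤
        σ * ∫ t in (-1 : ℝ)..1, f t := by
    set z := doubledNodes e x ε with hz
    have hzinj : Function.Injective z := doubledNodes_injective hε hεδ hδe hδx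
    have hzmem (o) : z o ∈ Set.Icc (-1 : ℝ) 1 := by
      rcases o with _ | ⟨i, b⟩
      · exact he
      · have h1 := (hxI i).1
        have h2 := hδb i
        cases b <;> simp [hz, doubledNodes] <;> constructor <;> linarith
    set P := Lagrange.interpolate Finset.univ z (f ∘ z)
    have hP (o) : P.eval (z o) = f (z o) :=
      Lagrange.eval_interpolate_at_node _ hzinj.injOn (Finset.mem_univ o)
    have hPe : P.eval e = f e := hP none
    have hPx (i : κ) : P.eval (x i) = f (x i) := by
      simpa [hz, doubledNodes] using hP (some (i, false))
    have hPdeg : P.natDegree ≤ 2 * Fintype.card κ := by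
      refine Polynomial.natDegree_le_of_degree_le
        ((Lagrange.degree_interpolate_le _ hzinj.injOn).trans ?_)
      rw [Finset.card_univ, ← hN, hN']
      simp
    have hQ := hrule P hPdeg
    simp only [hPe, hPx] at hQ
    have hPint : IntervalIntegrable (fun t => P.eval t) MeasureTheory.volume (-1) 1 :=
      P.continuous.intervalIntegrable _ _
    let J (t : ℝ) : ℝ := ∑ i, (Set.Icc (x i) (x i + ε)).indicator (fun _ => (1 : ℝ)) t
    have hJi (i : κ) : IntervalIntegrable
        ((Set.Icc (x i) (x i + ε)).indicator fun _ => (1 : ℝ)) MeasureTheory.volume (-1) 1 := by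
      rw [intervalIntegrable_iff_integrableOn_Ioc_of_le (by norm_num)]
      exact (MeasureTheory.integrable_const _).indicator measurableSet_Icc
    have hJ : IntervalIntegrable J MeasureTheory.volume (-1) 1 := by
      have := IntervalIntegrable.sum Finset.univ fun i _ => hJi i
      simpa [J, Finset.sum_fn] using this
    have hJle : ∫ t in (-1 : ℝ)..1, J t ≤ Fintype.card κ * ε := by
      rw [intervalIntegral.integral_finsetSum fun i _ => hJi i, ← nsmul_eq_mul]
      refine Finset.sum_le_card_nsmul _ _ _ fun i _ => ?_
      rw [intervalIntegral.integral_of_le (by norm_num),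
        MeasureTheory.integral_indicator_const _ measurableSet_Icc, smul_eq_mul, mul_one,
        MeasureTheory.measureReal_restrict_apply measurableSet_Icc]
      refine (MeasureTheory.measureReal_mono Set.inter_subset_left (by simp)).trans ?_
      simp [hε.le]
    have hpt (t : ℝ) (ht : t ∈ Set.Icc (-1 : ℝ) 1) : -K * J t ≤ σ * (f t - P.eval t) := by
      have hJ0 (i : κ) : 0 ≤ (Set.Icc (x i) (x i + ε)).indicator (fun _ => (1 : ℝ)) t :=
        Set.indicator_nonneg (fun _ _ => zero_le_one) t
      by_cases htE : ∃ i, t ∈ Set.Icc (x i) (x i + ε)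
      · obtain ⟨i, hi⟩ := htE
        have hJ1 : 1 ≤ J t := by
          have := Finset.single_le_sum (fun i _ => hJ0 i) (Finset.mem_univ i)
          rwa [Set.indicator_of_mem hi] at this
        have hPt : |P.eval t| ≤ N * (M * C) := by
          refine Lagrange.abs_eval_interpolate_le (fun o => hM _ (hzmem o)) (fun o => ?_) hzinj
          have h1 := prod_abs_sub_doubledNodes_le hε hzmem ht hi o
          have h2 := mul_pow_le_prod_abs_doubledNodes_sub hε hεδ hδ1 hδe hδx o
          have hcard : (Finset.univ.erase o).card = 2 * Fintype.card κ := by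
            rw [Finset.card_erase_of_mem (Finset.mem_univ o), Finset.card_univ, ← hN, hN']
            simp
          rw [hcard] at h1 h2
          refine h1.trans (le_of_eq_of_le ?_ (mul_le_mul_of_nonneg_left h2 (by positivity)))
          simp only [C, div_pow]
          field_simp
        have h3 : |σ * (f t - P.eval t)| ≤ K := by
          rw [abs_mul, hσ, one_mul]
          exact (abs_sub _ _).trans (add_le_add (hM t ht) hPt)
        nlinarith [neg_le_of_abs_le h3]
      · push Not at htE
        have hJt : J t = 0 :=
          Finset.sum_eq_zero fun i _ => Set.indicator_of_notMem (htE i) _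
        rw [hJt, mul_zero]
        by_cases hte : t = e
        · simp [hte, hPe]
        have h1 := hf.sub_interpolate_mul_prod_nonneg (by rw [← hN, hN']) hzinj hzmem ht
        rw [Fintype.prod_option, Fintype.prod_prod_type] at h1
        have h2 : 0 < ∏ i, ∏ b, (t - z (some (i, b))) := by
          refine Finset.prod_pos fun i _ => ?_
          have h := htE i
          simp only [hz, doubledNodes, Fintype.prod_bool, Option.elim, if_true,
            Bool.false_eq_true, if_false, add_zero]
          rw [Set.mem_Icc, not_and_or, not_le, not_le] at h
          rcases h with h | h
          · exact mul_pos_of_neg_of_neg (by linarith) (by linarith)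
          · exact mul_pos (by linarith) (by linarith)
        rw [← mul_assoc] at h1
        have h3 := nonneg_of_mul_nonneg_left h1 h2
        have hσ2 : σ * σ = 1 := by rw [← abs_mul_abs_self, hσ, one_mul]
        have h4 : 0 < σ * (t - e) := by
          refine lt_of_le_of_ne (hσe t ht) (Ne.symm (mul_ne_zero ?_ (sub_ne_zero.2 hte)))
          rintro rfl
          simp at hσ2
        refine nonneg_of_mul_nonneg_left (le_of_le_of_eq h3 ?_) h4
        calc (f t - P.eval t) * (t - e) = σ * σ * ((f t - P.eval t) * (t - e)) := by
              rw [hσ2, one_mul]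
          _ = _ := by ring
    have hmono := intervalIntegral.integral_mono_on (by norm_num) (hJ.const_mul (-K))
      ((hfint.sub hPint).const_mul σ) hpt
    rw [intervalIntegral.integral_const_mul, intervalIntegral.integral_const_mul,
      intervalIntegral.integral_sub hfint hPint, ← hQ] at hmono
    nlinarith
  by_contra! hlt
  set d := σ * (w₀ * f e + ∑ i, w i * f (x i)) - σ * ∫ t in (-1 : ℝ)..1, f t
  have hlim : Filter.Tendsto (fun ε : ℝ => K * Fintype.card κ * ε)
      (nhdsWithin 0 (Set.Ioi 0)) (nhds 0) := by
    have : Continuous fun ε : ℝ => K * Fintype.card κ * ε := by fun_prop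
    simpa using (this.tendsto 0).mono_left nhdsWithin_le_nhds
  have hle : d ≤ 0 := by
    refine ge_of_tendsto hlim ?_
    filter_upwards [Ioc_mem_nhdsGT hδ] with ε hε
    linarith [key ε hε.1 hε.2]
  linarith

/-- Hadamard-type inequality: for a `2n`-convex function `f` on `[-1,1]`,
`Rad^l_{n+1}(f) ≤ ∫_{-1}^1 f ≤ Rad^r_{n+1}(f)` for any left and right
Radau-type rules exact on `Π_{2n}`. -/
theorem radau_left_le_integral_le_radau_right
    (n : ℕ) (hn : 1 ≤ n)
    (x : Fin (n + 1) → ℝ) (hxinj : Function.Injective x)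
    (hx0 : x 0 = -1) (hx : ∀ i, i ≠ 0 → x i ∈ Set.Ioo (-1 : ℝ) 1)
    (w : Fin (n + 1) → ℝ)
    (hRl : ∀ p : Polynomial ℝ, p.natDegree ≤ 2 * n →
      ∑ i, w i * p.eval (x i) = ∫ t in (-1 : ℝ)..1, p.eval t)
    (y : Fin (n + 1) → ℝ) (hyinj : Function.Injective y)
    (hyl : y (Fin.last n) = 1)
    (hy : ∀ i, i ≠ Fin.last n → y i ∈ Set.Ioo (-1 : ℝ) 1)
    (v : Fin (n + 1) → ℝ)
    (hRr : ∀ p : Polynomial ℝ, p.natDegree ≤ 2 * n →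
      ∑ i, v i * p.eval (y i) = ∫ t in (-1 : ℝ)..1, p.eval t)
    (f : ℝ → ℝ) (hf : NConvexOn (2 * n) (Set.Icc (-1 : ℝ) 1) f) :
    ∑ i, w i * f (x i) ≤ (∫ t in (-1 : ℝ)..1, f t) ∧
      (∫ t in (-1 : ℝ)..1, f t) ≤ ∑ i, v i * f (y i) := by
  constructor
  · have h := NConvexOn.quadrature_le (κ := Fin n) (f := f) (by simpa using hf) (by simpa using hn)
      (e := -1) (σ := 1) (by simp) (by simp) (fun t ht => by linarith [ht.1])
      (x := fun i => x i.succ) (hxinj.comp (Fin.succ_injective n))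
      (fun i => (hx _ (Fin.succ_ne_zero i)).1.ne') (fun i => hx _ (Fin.succ_ne_zero i))
      (w₀ := w 0) (w := fun i => w i.succ) (fun p hp => by
        rw [← hRl p (by simpa using hp), Fin.sum_univ_succ, hx0])
    rwa [one_mul, one_mul, ← hx0, ← Fin.sum_univ_succ fun i => w i * f (x i), hx0] at h
  · have h := NConvexOn.quadrature_le (κ := Fin n) (f := f) (by simpa using hf) (by simpa using hn)
      (e := 1) (σ := -1) (by simp) (by simp) (fun t ht => by linarith [ht.2])
      (x := fun i => y i.castSucc) (hyinj.comp (Fin.castSucc_injective n))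
      (fun i => (hy _ (Fin.castSucc_ne_last i)).2.ne) (fun i => hy _ (Fin.castSucc_ne_last i))
      (w₀ := v (Fin.last n)) (w := fun i => v i.castSucc) (fun p hp => by
        rw [← hRr p (by simpa using hp), Fin.sum_univ_castSucc, hyl, add_comm])
    rw [Fin.sum_univ_castSucc, hyl]
    linarith
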